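/- For all ν ≥ 0 and all x ∈ (0, 1], I_ν(x) K_ν(x) + ln x ≤ I_ν(1) K_ν(1). -/

import Mathlib

open Real MeasureTheory Set Filter

/-- Modified Bessel function of the first kind `I_ν`. -/
noncomputable def besselI (ν x : ℝ) : ℝ :=
  ∑' n : ℕ, (x / 2) ^ (2 * (n : ℝ) + ν) / ((n.factorial : ℝ) * Real.Gamma ((n : ℝ) + ν + 1))

/-- Modified Bessel function of the second kind `K_ν`. -/
noncomputable def besselK (ν x : ℝ) : ℝ :=
  ∫ t in Ioi (0 : ℝ), Real.exp (-x * Real.cosh t) * Real.cosh (ν * t)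

/-- Bessel function of the first kind `J_ν`. -/
noncomputable def besselJ (ν x : ℝ) : ℝ :=
  ∑' n : ℕ, (-1 : ℝ) ^ n * (x / 2) ^ (2 * (n : ℝ) + ν) /
    ((n.factorial : ℝ) * Real.Gamma ((n : ℝ) + ν + 1))

/-- Modified Struve function of the first kind `L_ν`. -/
noncomputable def struveL (ν x : ℝ) : ℝ :=
  ∑' n : ℕ, (x / 2) ^ (2 * (n : ℝ) + ν + 1) /
    (Real.Gamma ((n : ℝ) + 3 / 2) * Real.Gamma ((n : ℝ) + ν + 3 / 2))

/-- Airy function `Ai`. -/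
noncomputable def airyAi (t : ℝ) : ℝ :=
  (1 / Real.pi) * ∫ s in Ioi (0 : ℝ), Real.cos (s ^ 3 / 3 + s * t)

/-- Landau constant `b_L = 2^{1/3} ⬝ sup_{t ≥ 0} Ai(t)`. -/
noncomputable def landau_bL : ℝ :=
  (2 : ℝ) ^ ((1 : ℝ) / 3) * sSup (airyAi '' Ici 0)

/-- Landau constant `c_L = sup_{t ≥ 0} t^{1/3} J₀(t)`. -/
noncomputable def landau_cL : ℝ :=
  sSup ((fun t : ℝ => t ^ ((1 : ℝ) / 3) * besselJ 0 t) '' Ici 0)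


/-- The entire function `g_ν` with `I_ν(x) = (x/2)^ν g_ν((x/2)²)`. -/
noncomputable def besselSeries (ν y : ℝ) : ℝ :=
  ∑' n : ℕ, y ^ n / ((n.factorial : ℝ) * Real.Gamma ((n : ℝ) + ν + 1))

lemma gamma_le_gamma_natCast_add {ν : ℝ} (hν : 0 ≤ ν) (n : ℕ) :
    Real.Gamma (ν + 1) ≤ Real.Gamma ((n : ℝ) + ν + 1) := by
  induction n with
  | zero => simp
  | succ n ih =>
    have hn : (0 : ℝ) ≤ n := n.cast_nonneg
    have h1 : ((n + 1 : ℕ) : ℝ) + ν + 1 = ((n : ℝ) + ν + 1) + 1 := by push_cast; ring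
    have hpos : 0 < Real.Gamma ((n : ℝ) + ν + 1) := Real.Gamma_pos_of_pos (by positivity)
    rw [h1, Real.Gamma_add_one (s := (n : ℝ) + ν + 1) (by positivity)]
    nlinarith [mul_nonneg (add_nonneg hn hν) hpos.le]

lemma summable_besselSeries {ν : ℝ} (hν : 0 ≤ ν) (y : ℝ) :
    Summable fun n : ℕ => y ^ n / ((n.factorial : ℝ) * Real.Gamma ((n : ℝ) + ν + 1)) := by
  have hG : 0 < Real.Gamma (ν + 1) := Real.Gamma_pos_of_pos (by positivity)
  refine Summable.of_norm_bounded
    ((Real.summable_pow_div_factorial |y|).mul_right (Real.Gamma (ν + 1))⁻¹) fun n => ?_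
  have h := gamma_le_gamma_natCast_add hν n
  have hf : (0 : ℝ) < n.factorial := by positivity
  rw [norm_div, norm_pow, Real.norm_eq_abs, Real.norm_of_nonneg (by positivity), ← div_eq_mul_inv,
    div_div]
  gcongr

lemma hasDerivAt_besselSeries {ν : ℝ} (hν : 0 ≤ ν) (y : ℝ) :
    HasDerivAt (besselSeries ν) (besselSeries (ν + 1) y) y := by
  have hG : 0 < Real.Gamma (ν + 1) := Real.Gamma_pos_of_pos (by positivity)
  set R : ℝ := |y| + 1
  have hR : 0 < R := by positivity
  have hterm (n : ℕ) (z : ℝ) : ((n + 1 : ℕ) : ℝ) * z ^ (n + 1 - 1) /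
      (((n + 1).factorial : ℝ) * Real.Gamma (((n + 1 : ℕ) : ℝ) + ν + 1)) =
      z ^ n / ((n.factorial : ℝ) * Real.Gamma ((n : ℝ) + (ν + 1) + 1)) := by
    have h1 : ((n + 1 : ℕ) : ℝ) + ν + 1 = (n : ℝ) + (ν + 1) + 1 := by push_cast; ring
    rw [h1, Nat.factorial_succ, Nat.add_sub_cancel]
    push_cast
    rw [mul_assoc ((n : ℝ) + 1), mul_div_mul_left _ _ (by positivity)]
  have hsum (z : ℝ) : Summable fun n : ℕ =>
      (n : ℝ) * z ^ (n - 1) / ((n.factorial : ℝ) * Real.Gamma ((n : ℝ) + ν + 1)) := by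
    rw [← summable_nat_add_iff 1]
    simp only [hterm]
    exact summable_besselSeries (by positivity) z
  have key := hasDerivAt_tsum_of_isPreconnected
    (g := fun (n : ℕ) z => z ^ n / ((n.factorial : ℝ) * Real.Gamma ((n : ℝ) + ν + 1)))
    (g' := fun (n : ℕ) z =>
      (n : ℝ) * z ^ (n - 1) / ((n.factorial : ℝ) * Real.Gamma ((n : ℝ) + ν + 1)))
    (t := Metric.ball 0 R) (y₀ := y) (y := y) (hsum R) Metric.isOpen_ball
    (convex_ball 0 R).isPreconnected (fun n z _ => (hasDerivAt_pow n z).div_const _)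
    (fun n z hz => by
      have hz' : |z| ≤ R := by simpa using (mem_ball_zero_iff.mp hz).le
      have hpos : 0 < Real.Gamma ((n : ℝ) + ν + 1) := Real.Gamma_pos_of_pos (by positivity)
      rw [norm_div, norm_mul, norm_pow, Real.norm_eq_abs z, Real.norm_of_nonneg (by positivity),
        Real.norm_of_nonneg (by positivity)]
      gcongr)
    (by simp [R]) (summable_besselSeries hν y) (by simp [R])
  have heq : ∑' n : ℕ, (n : ℝ) * y ^ (n - 1) /
      ((n.factorial : ℝ) * Real.Gamma ((n : ℝ) + ν + 1)) = besselSeries (ν + 1) y := by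
    rw [(hsum y).tsum_eq_zero_add]
    simp only [hterm]
    simp [besselSeries]
  rw [← heq]
  exact key

lemma besselSeries_eq_add {ν : ℝ} (hν : 0 ≤ ν) (y : ℝ) :
    besselSeries ν y = (ν + 1) * besselSeries (ν + 1) y + y * besselSeries (ν + 2) y := by
  have hterm (n : ℕ) : y ^ (n + 1) * ((n + 1 : ℕ) : ℝ) /
      (((n + 1).factorial : ℝ) * Real.Gamma (((n + 1 : ℕ) : ℝ) + (ν + 1) + 1)) =
      y * (y ^ n / ((n.factorial : ℝ) * Real.Gamma ((n : ℝ) + (ν + 2) + 1))) := by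
    have h1 : ((n + 1 : ℕ) : ℝ) + (ν + 1) + 1 = (n : ℝ) + (ν + 2) + 1 := by push_cast; ring
    have hpos : 0 < Real.Gamma ((n : ℝ) + (ν + 2) + 1) := Real.Gamma_pos_of_pos (by positivity)
    rw [h1, Nat.factorial_succ]
    push_cast
    field_simp
    ring
  have h2 := (summable_besselSeries (ν := ν + 2) (by positivity) y).mul_left y
  have hs : Summable fun n : ℕ => y ^ n * (n : ℝ) /
      ((n.factorial : ℝ) * Real.Gamma ((n : ℝ) + (ν + 1) + 1)) := by
    rw [← summable_nat_add_iff 1]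
    simpa only [hterm] using h2
  have h3 : y * besselSeries (ν + 2) y = ∑' n : ℕ, y ^ n * (n : ℝ) /
      ((n.factorial : ℝ) * Real.Gamma ((n : ℝ) + (ν + 1) + 1)) := by
    rw [hs.tsum_eq_zero_add]
    simp only [hterm, tsum_mul_left]
    simp [besselSeries]
  rw [h3, besselSeries, besselSeries, ← tsum_mul_left, ← Summable.tsum_add
    ((summable_besselSeries (ν := ν + 1) (by positivity) y).mul_left _) hs]
  refine tsum_congr fun n => ?_
  have hpos : 0 < Real.Gamma ((n : ℝ) + ν + 1) := Real.Gamma_pos_of_pos (by positivity)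
  have h4 : (n : ℝ) + (ν + 1) + 1 = ((n : ℝ) + ν + 1) + 1 := by ring
  rw [h4, Real.Gamma_add_one (s := (n : ℝ) + ν + 1) (by positivity)]
  field_simp
  ring

lemma besselSeries_zero (ν : ℝ) : besselSeries ν 0 = (Real.Gamma (ν + 1))⁻¹ := by
  rw [besselSeries, tsum_eq_single 0 fun n hn => by simp [hn]]
  simp

lemma besselSeries_nonneg {ν y : ℝ} (hν : 0 ≤ ν) (hy : 0 ≤ y) : 0 ≤ besselSeries ν y :=
  tsum_nonneg fun n => by
    have : 0 < Real.Gamma ((n : ℝ) + ν + 1) := Real.Gamma_pos_of_pos (by positivity)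
    positivity

lemma besselI_eq_rpow_mul_besselSeries (ν : ℝ) {x : ℝ} (hx : 0 < x) :
    besselI ν x = (x / 2) ^ ν * besselSeries ν ((x / 2) ^ 2) := by
  rw [besselI, besselSeries, ← tsum_mul_left]
  refine tsum_congr fun n => ?_
  have h : (x / 2) ^ (2 * (n : ℝ)) = ((x / 2) ^ 2) ^ n := by
    rw [← pow_mul, ← Real.rpow_natCast]
    push_cast
    rfl
  rw [Real.rpow_add (by positivity), h]
  ring

lemma besselI_nonneg {ν x : ℝ} (hν : 0 ≤ ν) (hx : 0 < x) : 0 ≤ besselI ν x := by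
  rw [besselI_eq_rpow_mul_besselSeries ν hx]
  exact mul_nonneg (by positivity) (besselSeries_nonneg hν (by positivity))

lemma besselI_add_one (ν : ℝ) {x : ℝ} (hx : 0 < x) :
    besselI (ν + 1) x = (x / 2) ^ ν * (x / 2) * besselSeries (ν + 1) ((x / 2) ^ 2) := by
  rw [besselI_eq_rpow_mul_besselSeries _ hx, Real.rpow_add_one (by positivity)]

lemma hasDerivAt_besselI {ν x : ℝ} (hν : 0 ≤ ν) (hx : 0 < x) :
    HasDerivAt (besselI ν) (ν / x * besselI ν x + besselI (ν + 1) x) x := by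
  have hlin : HasDerivAt (fun z : ℝ => z / 2) (1 / 2) x := (hasDerivAt_id x).div_const 2
  have hpow := hlin.rpow_const (p := ν) (Or.inl (by positivity))
  have hser := (hasDerivAt_besselSeries hν ((x / 2) ^ 2)).comp x (hlin.pow 2)
  have h := (hpow.mul hser).congr_of_eventuallyEq (f₁ := besselI ν) (by
    filter_upwards [lt_mem_nhds hx] with z hz
    exact besselI_eq_rpow_mul_besselSeries ν hz)
  refine h.congr_deriv ?_
  rw [besselI_add_one ν hx, besselI_eq_rpow_mul_besselSeries ν hx, Real.rpow_sub_one (by positivity)]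
  simp only [Function.comp, Pi.pow_apply, Nat.add_one_sub_one, pow_one, Nat.cast_ofNat]
  field_simp

lemma besselI_recurrence {ν x : ℝ} (hν : 0 ≤ ν) (hx : 0 < x) :
    besselI ν x = 2 * (ν + 1) / x * besselI (ν + 1) x + besselI (ν + 1 + 1) x := by
  rw [besselI_add_one (ν + 1) hx, besselI_add_one ν hx, besselI_eq_rpow_mul_besselSeries ν hx,
    besselSeries_eq_add hν, Real.rpow_add_one (by positivity), add_assoc ν 1 1, one_add_one_eq_two]
  field_simp

lemma hasDerivAt_besselI_add_one {ν x : ℝ} (hν : 0 ≤ ν) (hx : 0 < x) :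
    HasDerivAt (besselI (ν + 1)) (besselI ν x - (ν + 1) / x * besselI (ν + 1) x) x := by
  refine (hasDerivAt_besselI (ν := ν + 1) (by positivity) hx).congr_deriv ?_
  rw [besselI_recurrence hν hx]
  ring

/-- The integrand of the integral defining `K_ν(x)`. -/
noncomputable def besselKIntegrand (ν x t : ℝ) : ℝ :=
  Real.exp (-x * Real.cosh t) * Real.cosh (ν * t)

lemma continuous_besselKIntegrand (ν x : ℝ) : Continuous (besselKIntegrand ν x) := by
  unfold besselKIntegrand
  fun_prop

lemma integrable_exp_neg_mul_exp_add {a c : ℝ} (ha : 0 < a) (hc : 0 < c) :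
    Integrable fun t : ℝ => Real.exp (-(c * Real.exp t) + a * t) := by
  have h := integrableOn_image_iff_integrableOn_abs_deriv_smul (s := univ) MeasurableSet.univ
    (fun t _ => (Real.hasDerivAt_exp t).hasDerivWithinAt) Real.exp_injective.injOn
    (fun u : ℝ => u ^ (a - 1) * Real.exp (-c * u ^ (1 : ℝ)))
  rw [image_univ, Real.range_exp, integrableOn_univ] at h
  refine (h.mp (integrableOn_rpow_mul_exp_neg_mul_rpow (by linarith) one_pos hc)).congr
    (ae_of_all _ fun t => ?_)
  simp only [abs_of_pos (Real.exp_pos t), smul_eq_mul, Real.rpow_one]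
  rw [← Real.exp_mul, ← Real.exp_add, ← Real.exp_add]
  congr 1
  ring

lemma integral_exp_neg_mul_exp_add {a c : ℝ} (ha : 0 < a) (hc : 0 < c) :
    ∫ t : ℝ, Real.exp (-(c * Real.exp t) + a * t) = (1 / c) ^ a * Real.Gamma a := by
  have h := integral_image_eq_integral_abs_deriv_smul (s := univ) MeasurableSet.univ
    (fun t _ => (Real.hasDerivAt_exp t).hasDerivWithinAt) Real.exp_injective.injOn
    (fun u : ℝ => u ^ (a - 1) * Real.exp (-(c * u)))
  rw [image_univ, Real.range_exp, Real.integral_rpow_mul_exp_neg_mul_Ioi ha hc,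
    setIntegral_univ] at h
  rw [h]
  refine integral_congr_ae (ae_of_all _ fun t => ?_)
  simp only [abs_of_pos (Real.exp_pos t), smul_eq_mul]
  rw [← Real.exp_mul, ← Real.exp_add, ← Real.exp_add]
  congr 1
  ring

lemma besselKIntegrand_le {x : ℝ} (ν : ℝ) (hx : 0 < x) (t : ℝ) :
    besselKIntegrand ν x t ≤ (Real.exp (-(x / 2 * Real.exp t) + ν * t) +
      Real.exp (-(x / 2 * Real.exp (-t)) + ν * -t)) / 2 := by
  have h1 : Real.exp (-x * Real.cosh t) ≤ Real.exp (-(x / 2 * Real.exp t)) := by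
    rw [Real.exp_le_exp, Real.cosh_eq]
    nlinarith [mul_pos hx (Real.exp_pos (-t))]
  have h2 : Real.exp (-x * Real.cosh t) ≤ Real.exp (-(x / 2 * Real.exp (-t))) := by
    rw [Real.exp_le_exp, Real.cosh_eq]
    nlinarith [mul_pos hx (Real.exp_pos t)]
  rw [besselKIntegrand, Real.cosh_eq (ν * t), Real.exp_add, Real.exp_add, mul_neg]
  nlinarith [mul_le_mul_of_nonneg_right h1 (Real.exp_pos (ν * t)).le,
    mul_le_mul_of_nonneg_right h2 (Real.exp_pos (-(ν * t))).le]

lemma besselKIntegrand_nonneg (ν x t : ℝ) : 0 ≤ besselKIntegrand ν x t :=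
  mul_nonneg (Real.exp_pos _).le (Real.cosh_pos _).le

lemma besselKIntegrand_mono {μ ν t : ℝ} (x : ℝ) (h : |μ| ≤ |ν|) :
    besselKIntegrand μ x t ≤ besselKIntegrand ν x t := by
  unfold besselKIntegrand
  gcongr
  rw [Real.cosh_le_cosh, abs_mul, abs_mul]
  gcongr

lemma integrable_besselKIntegrand (ν : ℝ) {x : ℝ} (hx : 0 < x) :
    Integrable (besselKIntegrand ν x) := by
  have h := integrable_exp_neg_mul_exp_add (a := |ν| + 1) (c := x / 2) (by positivity)
    (by positivity)
  refine ((h.add h.comp_neg).div_const 2).mono'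
    (continuous_besselKIntegrand ν x).aestronglyMeasurable (ae_of_all _ fun t => ?_)
  rw [Real.norm_of_nonneg (besselKIntegrand_nonneg ν x t)]
  refine (besselKIntegrand_mono (ν := |ν| + 1) x ?_).trans (besselKIntegrand_le _ hx t)
  exact (by linarith : |ν| ≤ |ν| + 1).trans (le_abs_self _)

lemma besselK_nonneg (ν x : ℝ) : 0 ≤ besselK ν x :=
  integral_nonneg fun t => besselKIntegrand_nonneg ν x t

lemma besselK_mono {μ ν x : ℝ} (hx : 0 < x) (h : |μ| ≤ |ν|) : besselK μ x ≤ besselK ν x :=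
  integral_mono (integrable_besselKIntegrand μ hx).integrableOn
    (integrable_besselKIntegrand ν hx).integrableOn fun _ => besselKIntegrand_mono x h

lemma besselK_le {ν x : ℝ} (hν : 0 < ν) (hx : 0 < x) :
    besselK ν x ≤ Real.Gamma ν * (x / 2)⁻¹ ^ ν / 2 := by
  have h := integrable_exp_neg_mul_exp_add (a := ν) (c := x / 2) hν (by positivity)
  have hint := integral_exp_neg_mul_exp_add (a := ν) (c := x / 2) hν (by positivity)
  rw [one_div] at hint
  rw [mul_comm, ← hint, ← intervalIntegral.integral_Iic_add_Ioi (b := 0) h.integrableOn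
    h.integrableOn]
  have hneg := integral_comp_neg_Ioi 0 fun t : ℝ => Real.exp (-(x / 2 * Real.exp t) + ν * t)
  rw [neg_zero] at hneg
  rw [← hneg, add_comm, ← integral_add h.integrableOn h.comp_neg.integrableOn, ← integral_div]
  exact integral_mono (integrable_besselKIntegrand ν hx).integrableOn
    ((h.add h.comp_neg).div_const 2).integrableOn fun t => besselKIntegrand_le ν hx t

lemma cosh_mul_besselKIntegrand (ν x t : ℝ) :
    Real.cosh t * besselKIntegrand ν x t =
      (besselKIntegrand (ν + 1) x t + besselKIntegrand (ν - 1) x t) / 2 := by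
  simp only [besselKIntegrand, add_mul, sub_mul, one_mul, Real.cosh_add, Real.cosh_sub]
  ring

lemma hasDerivAt_besselK (ν : ℝ) {x : ℝ} (hx : 0 < x) :
    HasDerivAt (besselK ν) (-(besselK (ν + 1) x + besselK (ν - 1) x) / 2) x := by
  have hint (y : ℝ) (hy : 0 < y) : Integrable (fun t => Real.cosh t * besselKIntegrand ν y t)
      (volume.restrict (Ioi 0)) := by
    simp only [cosh_mul_besselKIntegrand]
    exact (((integrable_besselKIntegrand (ν + 1) hy).add
      (integrable_besselKIntegrand (ν - 1) hy)).div_const 2).integrableOn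
  have key := (hasDerivAt_integral_of_dominated_loc_of_deriv_le
    (μ := volume.restrict (Ioi (0 : ℝ))) (F := besselKIntegrand ν)
    (F' := fun y t => -(Real.cosh t * besselKIntegrand ν y t))
    (bound := fun t => Real.cosh t * besselKIntegrand ν (x / 2) t) (x₀ := x) (s := Ioi (x / 2))
    (Ioi_mem_nhds (by linarith))
    (Eventually.of_forall fun y => (continuous_besselKIntegrand ν y).aestronglyMeasurable)
    (integrable_besselKIntegrand ν hx).integrableOn (hint x hx).neg.aestronglyMeasurable
    (ae_of_all _ fun t y hy => by
      rw [norm_neg, Real.norm_of_nonneg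
        (mul_nonneg (Real.cosh_pos t).le (besselKIntegrand_nonneg ν y t))]
      have := Real.cosh_pos t
      have := Real.cosh_pos (ν * t)
      have := (mem_Ioi.mp hy).le
      unfold besselKIntegrand
      gcongr)
    (hint (x / 2) (by positivity))
    (ae_of_all _ fun t y _ => by
      have h := (((hasDerivAt_neg y).mul_const (Real.cosh t)).exp).mul_const (Real.cosh (ν * t))
      refine h.congr_deriv ?_
      unfold besselKIntegrand
      ring)).2
  refine key.congr_deriv ?_
  simp only [cosh_mul_besselKIntegrand]
  rw [integral_neg, integral_div, integral_add (integrable_besselKIntegrand _ hx).integrableOn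
    (integrable_besselKIntegrand _ hx).integrableOn, neg_div]
  rfl

lemma besselK_recurrence (ν : ℝ) {x : ℝ} (hx : 0 < x) :
    ν * besselK ν x = x / 2 * (besselK (ν + 1) x - besselK (ν - 1) x) := by
  have hderiv (t : ℝ) : HasDerivAt (fun t => Real.exp (-x * Real.cosh t) * Real.sinh (ν * t))
      (ν * besselKIntegrand ν x t -
        x / 2 * (besselKIntegrand (ν + 1) x t - besselKIntegrand (ν - 1) x t)) t := by
    have h1 := (((Real.hasDerivAt_cosh t).const_mul (-x)).exp).mul
      (((hasDerivAt_id t).const_mul ν).sinh)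
    refine h1.congr_deriv ?_
    simp only [besselKIntegrand, add_mul, sub_mul, one_mul, Real.cosh_add, Real.cosh_sub, id]
    ring
  have hi (μ : ℝ) := (integrable_besselKIntegrand μ hx).integrableOn (s := Ioi 0)
  have hd : IntegrableOn (fun t => x / 2 *
      (besselKIntegrand (ν + 1) x t - besselKIntegrand (ν - 1) x t)) (Ioi 0) :=
    ((hi (ν + 1)).sub (hi (ν - 1))).const_mul (x / 2)
  have hf' := ((hi ν).const_mul ν).sub hd
  have hf : IntegrableOn (fun t => Real.exp (-x * Real.cosh t) * Real.sinh (ν * t)) (Ioi 0) := by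
    refine (hi ν).mono' (Continuous.aestronglyMeasurable (by fun_prop)) (ae_of_all _ fun t => ?_)
    rw [norm_mul, Real.norm_of_nonneg (Real.exp_pos _).le, Real.norm_eq_abs]
    unfold besselKIntegrand
    gcongr
    rw [Real.abs_sinh, ← Real.cosh_abs (ν * t)]
    exact (Real.sinh_lt_cosh _).le
  have h := integral_Ioi_of_hasDerivAt_of_tendsto
    (hderiv 0).continuousAt.continuousWithinAt (fun t _ => hderiv t) hf'
    (tendsto_zero_of_hasDerivAt_of_integrableOn_Ioi (fun t _ => hderiv t) hf' hf)
  rw [integral_sub ((hi ν).const_mul ν) hd, integral_const_mul, integral_const_mul,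
    integral_sub (hi (ν + 1)) (hi (ν - 1))] at h
  simp only [mul_zero, Real.sinh_zero, sub_zero] at h
  exact sub_eq_zero.mp h

lemma hasDerivAt_besselK_sub (ν : ℝ) {x : ℝ} (hx : 0 < x) :
    HasDerivAt (besselK ν) (ν / x * besselK ν x - besselK (ν + 1) x) x := by
  refine (hasDerivAt_besselK ν hx).congr_deriv ?_
  have h := besselK_recurrence ν hx
  field_simp
  linarith

lemma hasDerivAt_besselK_add_one (ν : ℝ) {x : ℝ} (hx : 0 < x) :
    HasDerivAt (besselK (ν + 1)) (-besselK ν x - (ν + 1) / x * besselK (ν + 1) x) x := by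
  refine (hasDerivAt_besselK (ν + 1) hx).congr_deriv ?_
  have h := besselK_recurrence (ν + 1) hx
  rw [add_sub_cancel_right] at h ⊢
  field_simp
  linarith

/-- `x (I_ν K_{ν+1} + I_{ν+1} K_ν)`, which is `x` times the Wronskian of `K_ν` and `I_ν`. -/
noncomputable def besselWronskian (ν x : ℝ) : ℝ :=
  x * (besselI ν x * besselK (ν + 1) x + besselI (ν + 1) x * besselK ν x)

lemma hasDerivAt_besselWronskian {ν x : ℝ} (hν : 0 ≤ ν) (hx : 0 < x) :
    HasDerivAt (besselWronskian ν) 0 x := by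
  have h := (hasDerivAt_id x).mul
    (((hasDerivAt_besselI hν hx).mul (hasDerivAt_besselK_add_one ν hx)).add
      ((hasDerivAt_besselI_add_one hν hx).mul (hasDerivAt_besselK_sub ν hx)))
  refine h.congr_deriv ?_
  simp only [id, Pi.add_apply, Pi.mul_apply]
  field_simp
  ring

lemma besselWronskian_le {ν x : ℝ} (hν : 0 ≤ ν) (hx : 0 < x) :
    besselWronskian ν x ≤ Real.Gamma (ν + 1) * (besselSeries ν ((x / 2) ^ 2) +
      x / 2 * besselSeries (ν + 1) ((x / 2) ^ 2)) := by
  have hK := besselK_le (ν := ν + 1) (by positivity) hx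
  have hmono : besselK ν x ≤ besselK (ν + 1) x :=
    besselK_mono hx (by rw [abs_of_nonneg hν, abs_of_nonneg (by positivity)]; linarith)
  have hI := besselI_nonneg hν hx
  have hI' := besselI_nonneg (ν := ν + 1) (by positivity) hx
  calc besselWronskian ν x
      ≤ x * (besselI ν x * (Real.Gamma (ν + 1) * (x / 2)⁻¹ ^ (ν + 1) / 2) +
          besselI (ν + 1) x * (Real.Gamma (ν + 1) * (x / 2)⁻¹ ^ (ν + 1) / 2)) := by
        unfold besselWronskian
        gcongr
        exact hmono.trans hK
    _ = _ := by
        have hp : 0 < (x / 2) ^ ν := by positivity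
        rw [besselI_add_one ν hx, besselI_eq_rpow_mul_besselSeries ν hx,
          Real.inv_rpow (by positivity), Real.rpow_add_one (by positivity)]
        field_simp

lemma besselWronskian_le_one {ν x : ℝ} (hν : 0 ≤ ν) (hx : 0 < x) : besselWronskian ν x ≤ 1 := by
  have hanti : AntitoneOn (besselWronskian ν) (Ioi 0) := by
    refine antitoneOn_of_deriv_nonpos (convex_Ioi 0)
      (fun y hy => (hasDerivAt_besselWronskian hν hy).continuousAt.continuousWithinAt) ?_ ?_ <;>
      rw [interior_Ioi]
    · exact fun y hy =>
        (hasDerivAt_besselWronskian hν hy).differentiableAt.differentiableWithinAt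
    · exact fun y hy => (hasDerivAt_besselWronskian hν hy).deriv.le
  have hc (μ : ℝ) (hμ : 0 ≤ μ) : Continuous (besselSeries μ) :=
    continuous_iff_continuousAt.mpr fun y => (hasDerivAt_besselSeries hμ y).continuousAt
  have hc0 := hc ν hν
  have hc1 := hc (ν + 1) (by positivity)
  have hlim : Tendsto (fun y : ℝ => Real.Gamma (ν + 1) * (besselSeries ν ((y / 2) ^ 2) +
      y / 2 * besselSeries (ν + 1) ((y / 2) ^ 2))) (nhdsWithin 0 (Ioi 0)) (nhds 1) := by
    have hG : Real.Gamma (ν + 1) ≠ 0 := (Real.Gamma_pos_of_pos (by positivity)).ne'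
    refine Tendsto.mono_left ?_ nhdsWithin_le_nhds
    refine Continuous.tendsto' (by fun_prop) _ _ ?_
    simp [besselSeries_zero, hG]
  refine ge_of_tendsto hlim ?_
  filter_upwards [Ioo_mem_nhdsGT hx] with y hy
  exact (hanti hy.1 hx hy.2.le).trans (besselWronskian_le hν hy.1)

lemma monotoneOn_besselI_mul_besselK_add_log {ν : ℝ} (hν : 0 ≤ ν) :
    MonotoneOn (fun x => besselI ν x * besselK ν x + Real.log x) (Ioi 0) := by
  have hderiv (x : ℝ) (hx : 0 < x) :=
    ((hasDerivAt_besselI hν hx).mul (hasDerivAt_besselK_sub ν hx)).add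
      (Real.hasDerivAt_log hx.ne')
  refine monotoneOn_of_deriv_nonneg (convex_Ioi 0)
    (fun x hx => (hderiv x hx).continuousAt.continuousWithinAt) ?_ ?_ <;> rw [interior_Ioi]
  · exact fun x hx => (hderiv x hx).differentiableAt.differentiableWithinAt
  · intro x hx
    have hx0 : 0 < x := hx
    refine (hderiv x hx).deriv.symm ▸ ?_
    have hW := besselWronskian_le_one hν hx0
    have hI := besselI_nonneg hν hx0
    have hI' := besselI_nonneg (ν := ν + 1) (by positivity) hx0
    have hK := besselK_nonneg ν x
    have heq : (ν / x * besselI ν x + besselI (ν + 1) x) * besselK ν x +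
        besselI ν x * (ν / x * besselK ν x - besselK (ν + 1) x) + x⁻¹ =
        2 * ν / x * (besselI ν x * besselK ν x) + 2 * (besselI (ν + 1) x * besselK ν x) +
          (1 - besselWronskian ν x) / x := by
      unfold besselWronskian
      field_simp
      ring
    rw [heq]
    have := sub_nonneg.mpr hW
    positivity

theorem stmt8 (ν x : ℝ) (hν : 0 ≤ ν) (hx : x ∈ Ioc (0 : ℝ) 1) :
    besselI ν x * besselK ν x + Real.log x ≤ besselI ν 1 * besselK ν 1 := by
  simpa using monotoneOn_besselI_mul_besselK_add_log hν hx.1 (mem_Ioi.mpr one_pos) hx.2
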